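/- arXiv:2102.09599 — 3 statements merged into one kernel-verified Lean document; each statement's English description precedes it below -/
import Mathlib

section
/- Let m ≥ 2, d ≥ 1, k > 0, 0 < η with m·η ≤ 1, 0 < τ < 1, b ≥ 0, and L ≥ 0. Let f : ℝ^d → ℝ^m be L-Lipschitz with respect to the Euclidean norms, with f(X) ∈ Δ_{m,η} for every X ∈ ℝ^d. Set ε := √m·L·b·k·log(1/τ) + (m−1)·log Γ(k·η) + log Γ(k·(1−(m−1)·η)) − m·log Γ(k/m) and δ := 1 − μ_{k,p*}(S_τ). Then for all X, X' ∈ ℝ^d with ‖X − X'‖₂ ≤ b and every Borel set S ⊆ ℝ^{m−1}, one has μ_{k,f(X)}(S) ≤ exp(ε)·μ_{k,f(X')}(S) + δ; that is, the composition of the Dirichlet mechanism Dir_k with f is (ε,δ)-differentially private for b-adjacent inputs. -/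
open MeasureTheory

noncomputable section

/-- The η-restricted simplex Δ_{m,η} ⊆ ℝ^m. -/
def restrictedSimplex (m : ℕ) (η : ℝ) : Set (EuclideanSpace ℝ (Fin m)) :=
  {x | (∑ i, x i) = 1 ∧ ∀ i, η ≤ x i}

/-- The open set T = {x ∈ ℝ^{m-1} : x_i > 0, ∑ x_i < 1} (here with m = n+1). -/
def simplexInterior (n : ℕ) : Set (EuclideanSpace ℝ (Fin n)) :=
  {x | (∀ i, 0 < x i) ∧ (∑ i, x i) < 1}

/-- The Dirichlet mechanism Dir_k(p), expressed as a measure μ_{k,p} on the first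
m−1 coordinates (here m = n+1): Lebesgue measure restricted to T with the Dirichlet
density. -/
def dirichletMeasure (n : ℕ) (k : ℝ) (p : EuclideanSpace ℝ (Fin (n+1))) :
    Measure (EuclideanSpace ℝ (Fin n)) :=
  (volume.restrict (simplexInterior n)).withDensity fun x =>
    ENNReal.ofReal (Real.Gamma k *
      (∏ i : Fin n, (x i) ^ (k * p i.castSucc - 1)) *
      (1 - ∑ i, x i) ^ (k * p (Fin.last n) - 1) /
      ∏ i, Real.Gamma (k * p i))

/-- The coordinate representation S_τ ⊆ ℝ^{m-1} of Δ_{m,τ} (here m = n+1). -/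
def restrictedSimplexCoord (n : ℕ) (τ : ℝ) : Set (EuclideanSpace ℝ (Fin n)) :=
  {x ∈ simplexInterior n | (∀ i, τ ≤ x i) ∧ τ ≤ 1 - ∑ i, x i}

/-- The vertex p* = (η, …, η, 1 − (m−1)η) of Δ_{m,η} (here m = n+1). -/
def pstar (n : ℕ) (η : ℝ) : EuclideanSpace ℝ (Fin (n+1)) :=
  WithLp.toLp 2 fun i => if i = Fin.last n then 1 - n * η else η


/-- Normalised one-dimensional slice density. -/
def sliceDens (a c s t : ℝ) : ℝ :=
  t ^ (a - 1) / Real.Gamma a * ((s - t) ^ (c - 1) / Real.Gamma c)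

lemma measurable_sliceDens (a c s : ℝ) : Measurable (sliceDens a c s) := by
  unfold sliceDens; fun_prop

lemma sliceDens_pos {a c s t : ℝ} (ha : 0 < a) (hc : 0 < c) (ht : 0 < t) (hts : t < s) :
    0 < sliceDens a c s t := by
  unfold sliceDens
  have := Real.Gamma_pos_of_pos ha
  have := Real.Gamma_pos_of_pos hc
  have : 0 < s - t := by linarith
  positivity

lemma lintegral_sliceDens {a c s : ℝ} (ha : 0 < a) (hc : 0 < c) (hs : 0 < s) :
    ∫⁻ t in Set.Ioo 0 s, ENNReal.ofReal (sliceDens a c s t)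
      = ENNReal.ofReal (s ^ (a + c - 1) / Real.Gamma (a + c)) := by
  have hga := Real.Gamma_pos_of_pos ha
  have hgc := Real.Gamma_pos_of_pos hc
  have hgac := Real.Gamma_pos_of_pos (add_pos ha hc)
  have himg : Set.Ioo 0 s = (fun u : ℝ => s * u) '' Set.Ioo 0 1 := by
    ext t
    constructor
    · rintro ⟨h0, h1⟩
      exact ⟨t / s, ⟨by positivity, by rwa [div_lt_one hs]⟩, by field_simp⟩
    · rintro ⟨u, ⟨h0, h1⟩, rfl⟩
      exact ⟨by positivity, by nlinarith⟩
  have h1 := ProbabilityTheory.lintegral_betaPDF_eq_one ha hc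
  rw [ProbabilityTheory.lintegral_betaPDF] at h1
  rw [himg, lintegral_image_eq_lintegral_abs_deriv_mul measurableSet_Ioo
    (f' := fun _ => s) (fun x _ => by
      simpa using ((hasDerivAt_id x).const_mul s).hasDerivWithinAt)
    (fun x _ y _ h => mul_left_cancel₀ hs.ne' h)]
  have : ∀ x ∈ Set.Ioo (0:ℝ) 1, ENNReal.ofReal |s| * ENNReal.ofReal (sliceDens a c s (s * x))
     = ENNReal.ofReal (s ^ (a + c - 1) / Real.Gamma (a + c)) *
      ENNReal.ofReal (1 / ProbabilityTheory.beta a c * x ^ (a - 1) * (1 - x) ^ (c - 1)) := by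
    rintro x ⟨hx0, hx1⟩
    rw [← ENNReal.ofReal_mul (abs_nonneg _), ← ENNReal.ofReal_mul (by positivity), abs_of_pos hs]
    congr 1
    have e1 : s - s * x = s * (1 - x) := by ring
    have e2 : s ^ (a + c - 1) = s * s ^ (a - 1) * s ^ (c - 1) := by
      rw [mul_assoc, ← Real.rpow_add hs]
      nth_rewrite 2 [← Real.rpow_one s]
      rw [← Real.rpow_add hs]
      congr 1; ring
    unfold sliceDens ProbabilityTheory.beta
    rw [e1, Real.mul_rpow hs.le hx0.le, Real.mul_rpow hs.le (by linarith), e2]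
    field_simp
  rw [setLIntegral_congr_fun measurableSet_Ioo this, lintegral_const_mul _ (by fun_prop), h1, mul_one]

/-- Symmetrised slice density. -/
def symDens (a c s t : ℝ) : ℝ := sliceDens a c s t + sliceDens a c s (s - t)

lemma symDens_eq {a c s t : ℝ} (ht : 0 < t) (hts : t < s) :
    symDens a c s t = 2 / (Real.Gamma a * Real.Gamma c) *
      Real.exp (((a + c) / 2 - 1) * (Real.log t + Real.log (s - t))) *
      Real.cosh ((c - a) / 2 * (Real.log (s - t) - Real.log t)) := by
  have h : 0 < s - t := by linarith
  unfold symDens sliceDens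
  rw [sub_sub_cancel, Real.rpow_def_of_pos ht, Real.rpow_def_of_pos ht, Real.rpow_def_of_pos h,
    Real.rpow_def_of_pos h, Real.cosh_eq]
  set x := Real.log t
  set y := Real.log (s - t)
  have e : ∀ A B : ℝ, Real.exp A / Real.Gamma a * (Real.exp B / Real.Gamma c)
    = Real.exp (A + B) / (Real.Gamma a * Real.Gamma c) := by
    intro A B; rw [Real.exp_add, div_mul_div_comm]
  rw [e, e]
  have e1 : x * (a - 1) + y * (c - 1)
    = ((a + c) / 2 - 1) * (x + y) + (c - a) / 2 * (y - x) := by ring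
  have e2 : y * (a - 1) + x * (c - 1)
    = ((a + c) / 2 - 1) * (x + y) + -((c - a) / 2 * (y - x)) := by ring
  rw [e1, e2, Real.exp_add, Real.exp_add]
  ring

lemma cosh_mul_le {θ θ' x y : ℝ} (h0 : 0 ≤ θ) (h1 : θ ≤ θ') (hxy : |x| ≤ |y|) :
    Real.cosh (θ' * x) * Real.cosh (θ * y) ≤ Real.cosh (θ * x) * Real.cosh (θ' * y) := by
  have key : ∀ x y : ℝ, 0 ≤ x → x ≤ y →
    Real.cosh (θ' * x) * Real.cosh (θ * y) ≤ Real.cosh (θ * x) * Real.cosh (θ' * y) := by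
    intro x y hx hxy
    have a1 : Real.cosh (θ' * x + θ * y) ≤ Real.cosh (θ * x + θ' * y) := by
      rw [Real.cosh_le_cosh, abs_of_nonneg (by nlinarith), abs_of_nonneg (by nlinarith)]
      nlinarith
    have a2 : Real.cosh (θ' * x - θ * y) ≤ Real.cosh (θ * x - θ' * y) := by
      rw [Real.cosh_le_cosh, abs_sub_comm (θ * x), abs_of_nonneg (a := θ' * y - θ * x) (by nlinarith)]
      rw [abs_le]; constructor <;> nlinarith
    rw [Real.cosh_add, Real.cosh_add] at a1
    rw [Real.cosh_sub, Real.cosh_sub] at a2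
    linarith
  have := key |x| |y| (abs_nonneg _) hxy
  have hθ' : 0 ≤ θ' := h0.trans h1
  have e : ∀ t x : ℝ, 0 ≤ t → Real.cosh (t * |x|) = Real.cosh (t * x) := by
    intro t x ht
    rw [← Real.cosh_abs (t * x), abs_mul, abs_of_nonneg ht]
  rwa [e _ _ hθ', e _ _ h0, e _ _ h0, e _ _ hθ'] at this

lemma symDens_mul_le {a c a' c' s t r : ℝ} (ha' : 0 < a') (h1 : a' ≤ a) (h2 : a ≤ c)
    (hsum : a + c = a' + c') (ht : 0 < t) (hts : t ≤ s - t) (htr : t ≤ r) (hrs : r ≤ s - t) :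
    symDens a' c' s r * symDens a c s t ≤ symDens a c s r * symDens a' c' s t := by
  have ha : 0 < a := by linarith
  have hc : 0 < c := by linarith
  have hc' : 0 < c' := by linarith
  have hr : 0 < r := by linarith
  rw [symDens_eq hr (by linarith), symDens_eq hr (by linarith), symDens_eq ht (by linarith),
    symDens_eq ht (by linarith), ← hsum]
  have hl1 : Real.log t ≤ Real.log r := Real.log_le_log ht htr
  have hl2 : Real.log t ≤ Real.log (s - r) := Real.log_le_log ht (by linarith)
  have hl3 : Real.log r ≤ Real.log (s - t) := Real.log_le_log hr (by linarith)
  have hl4 : Real.log (s - r) ≤ Real.log (s - t) := Real.log_le_log (by linarith) (by linarith)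
  have hc := cosh_mul_le (θ := (c - a) / 2) (θ' := (c' - a') / 2)
    (x := Real.log (s - r) - Real.log r) (y := Real.log (s - t) - Real.log t) (by linarith)
    (by linarith) (by
      rw [abs_of_nonneg (a := Real.log (s - t) - Real.log t) (by linarith), abs_le]
      constructor <;> linarith)
  have hga := Real.Gamma_pos_of_pos ha
  have hgc := Real.Gamma_pos_of_pos (show 0 < c by linarith)
  have hga' := Real.Gamma_pos_of_pos ha'
  have hgc' := Real.Gamma_pos_of_pos hc'
  set P := 2 / (Real.Gamma a * Real.Gamma c)
  set P' := 2 / (Real.Gamma a' * Real.Gamma c')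
  set E1 := Real.exp (((a + c) / 2 - 1) * (Real.log r + Real.log (s - r)))
  set E2 := Real.exp (((a + c) / 2 - 1) * (Real.log t + Real.log (s - t)))
  have hP : 0 ≤ P * P' * E1 * E2 := by positivity
  have := mul_le_mul_of_nonneg_left hc hP
  linarith [this]

lemma lintegral_reflect (s l u : ℝ) (g : ℝ → ENNReal) (h : l + u = s) :
    ∫⁻ t in Set.Icc l u, g (s - t) = ∫⁻ t in Set.Icc l u, g t := by
  have hp : MeasurePreserving (fun t : ℝ => s - t) volume volume :=
    Measure.measurePreserving_sub_left volume s
  have he : MeasurableEmbedding (fun t : ℝ => s - t) :=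
    (MeasurableEquiv.subLeft s).measurableEmbedding
  have := hp.setLIntegral_comp_preimage_emb he g (Set.Icc l u)
  rw [← this]
  congr 2
  ext t
  simp only [Set.mem_preimage, Set.mem_Icc]
  constructor <;> rintro ⟨_, _⟩ <;> constructor <;> linarith

lemma lintegral_reflect_Ioo (s l u : ℝ) (g : ℝ → ENNReal) (h : l + u = s) :
    ∫⁻ t in Set.Ioo l u, g (s - t) = ∫⁻ t in Set.Ioo l u, g t := by
  rw [Measure.restrict_congr_set Ioo_ae_eq_Icc, lintegral_reflect s l u g h]

lemma measurable_symDens (a c s : ℝ) : Measurable (symDens a c s) := by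
  unfold symDens
  exact (measurable_sliceDens a c s).add ((measurable_sliceDens a c s).comp (by fun_prop))

lemma symDens_pos {a c s t : ℝ} (ha : 0 < a) (hc : 0 < c) (ht : 0 < t) (hts : t < s) :
    0 < symDens a c s t :=
  add_pos (sliceDens_pos ha hc ht hts) (sliceDens_pos ha hc (by linarith) (by linarith))

lemma symDens_symm (a c s t : ℝ) : symDens a c s (s - t) = symDens a c s t := by
  unfold symDens; rw [sub_sub_cancel, add_comm]

lemma lintegral_symDens_Icc {a c s t : ℝ} (ha : 0 < a) (hc : 0 < c) (ht : 0 < t) :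
    ∫⁻ r in Set.Icc t (s - t), ENNReal.ofReal (symDens a c s r)
      = 2 * ∫⁻ r in Set.Icc t (s - t), ENNReal.ofReal (sliceDens a c s r) := by
  have : ∀ r ∈ Set.Icc t (s - t), ENNReal.ofReal (symDens a c s r)
      = ENNReal.ofReal (sliceDens a c s r) + ENNReal.ofReal (sliceDens a c s (s - r)) := by
    rintro r ⟨h1, h2⟩
    exact ENNReal.ofReal_add (sliceDens_pos ha hc (by linarith) (by linarith)).le
      (sliceDens_pos ha hc (by linarith) (by linarith)).le
  rw [setLIntegral_congr_fun measurableSet_Icc this,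
    lintegral_add_left (measurable_sliceDens a c s).ennreal_ofReal,
    lintegral_reflect s t (s - t) (fun r => ENNReal.ofReal (sliceDens a c s r)) (by ring), two_mul]

lemma lintegral_symDens_Ioo {a c s : ℝ} (ha : 0 < a) (hc : 0 < c) :
    ∫⁻ r in Set.Ioo 0 s, ENNReal.ofReal (symDens a c s r)
      = 2 * ∫⁻ r in Set.Ioo 0 s, ENNReal.ofReal (sliceDens a c s r) := by
  have : ∀ r ∈ Set.Ioo 0 s, ENNReal.ofReal (symDens a c s r)
      = ENNReal.ofReal (sliceDens a c s r) + ENNReal.ofReal (sliceDens a c s (s - r)) := by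
    rintro r ⟨h1, h2⟩
    exact ENNReal.ofReal_add (sliceDens_pos ha hc (by linarith) (by linarith)).le
      (sliceDens_pos ha hc (by linarith) (by linarith)).le
  rw [setLIntegral_congr_fun measurableSet_Ioo this,
    lintegral_add_left (measurable_sliceDens a c s).ennreal_ofReal,
    lintegral_reflect_Ioo s 0 s (fun r => ENNReal.ofReal (sliceDens a c s r)) (by ring), two_mul]

lemma slice_compare_aux {a c a' c' s t : ℝ} (ha' : 0 < a') (h1 : a' ≤ a) (h2 : a ≤ c)
    (hsum : a + c = a' + c') (ht : 0 < t) :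
    ∫⁻ r in Set.Icc t (s - t), ENNReal.ofReal (sliceDens a' c' s r)
      ≤ ∫⁻ r in Set.Icc t (s - t), ENNReal.ofReal (sliceDens a c s r) := by
  have ha : 0 < a := by linarith
  have hc : 0 < c := by linarith
  have hc' : 0 < c' := by linarith
  rcases lt_or_ge (s - t) t with hlt | hts
  · rw [Set.Icc_eq_empty (by linarith)]; simp
  have hs : 0 < s := by linarith
  have two_ne : (2 : ENNReal) ≠ 0 := by norm_num
  have two_nt : (2 : ENNReal) ≠ ⊤ := by norm_num
  rw [← ENNReal.mul_le_mul_iff_right two_ne two_nt, ← lintegral_symDens_Icc ha hc ht,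
    ← lintegral_symDens_Icc ha' hc' ht]
  have hp := symDens_pos ha hc ht (s := s) (by linarith)
  have hp' := symDens_pos ha' hc' ht (s := s) (by linarith)
  rcases le_total (symDens a' c' s t) (symDens a c s t) with hle | hle
  · refine setLIntegral_mono (measurable_symDens _ _ _).ennreal_ofReal ?_
    rintro r ⟨hr1, hr2⟩
    apply ENNReal.ofReal_le_ofReal
    have := symDens_mul_le ha' h1 h2 hsum ht hts hr1 hr2
    have hpr := symDens_pos ha hc (t := r) (s := s) (by linarith) (by linarith)
    have h3 := mul_le_mul_of_nonneg_left hle hpr.le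
    exact le_of_mul_le_mul_right (this.trans h3) hp
  · have hsub : Set.Icc t (s - t) ⊆ Set.Ioo 0 s := fun r hr => ⟨by linarith [hr.1], by linarith [hr.2]⟩
    have split : ∀ g : ℝ → ENNReal, ∫⁻ r in Set.Ioo 0 s, g r
        = (∫⁻ r in Set.Icc t (s - t), g r) + ∫⁻ r in Set.Ioo 0 s \ Set.Icc t (s - t), g r := by
      intro g
      rw [← lintegral_inter_add_sdiff g (Set.Ioo 0 s) (measurableSet_Icc (a := t) (b := s - t)),
        Set.inter_eq_right.mpr hsub]
    have e1 := split (fun r => ENNReal.ofReal (symDens a c s r))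
    have e2 := split (fun r => ENNReal.ofReal (symDens a' c' s r))
    have tot : ∫⁻ r in Set.Ioo 0 s, ENNReal.ofReal (symDens a c s r)
      = ∫⁻ r in Set.Ioo 0 s, ENNReal.ofReal (symDens a' c' s r) := by
      rw [lintegral_symDens_Ioo ha hc, lintegral_symDens_Ioo ha' hc',
        lintegral_sliceDens ha hc hs, lintegral_sliceDens ha' hc' hs, hsum]
    have fin : ∫⁻ r in Set.Ioo 0 s, ENNReal.ofReal (symDens a c s r) ≠ ⊤ := by
      rw [lintegral_symDens_Ioo ha hc, lintegral_sliceDens ha hc hs]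
      exact ENNReal.mul_ne_top two_nt ENNReal.ofReal_ne_top
    have out : ∫⁻ r in Set.Ioo 0 s \ Set.Icc t (s - t), ENNReal.ofReal (symDens a c s r)
      ≤ ∫⁻ r in Set.Ioo 0 s \ Set.Icc t (s - t), ENNReal.ofReal (symDens a' c' s r) := by
      refine setLIntegral_mono (measurable_symDens _ _ _).ennreal_ofReal ?_
      have small : ∀ r, 0 < r → r ≤ t → symDens a c s r ≤ symDens a' c' s r := by
        intro r hr0 hrt
        have := symDens_mul_le ha' h1 h2 hsum hr0 (r := t) (s := s) (by linarith) hrt (by linarith)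
        have hpr := symDens_pos ha hc (t := r) (s := s) (by linarith) (by linarith)
        have h3 := mul_le_mul_of_nonneg_right hle hpr.le
        exact le_of_mul_le_mul_left (h3.trans this) hp
      rintro r ⟨⟨hr1, hr2⟩, hr3⟩
      apply ENNReal.ofReal_le_ofReal
      rcases le_total r t with h | h
      · exact small r hr1 h
      · have : s - t < r := by
          by_contra hcon
          exact hr3 ⟨h, by linarith⟩
        rw [← symDens_symm a c, ← symDens_symm a' c']
        exact small _ (by linarith) (by linarith)
    rw [tot, e2] at e1
    have fin2 : ∫⁻ r in Set.Ioo 0 s \ Set.Icc t (s - t), ENNReal.ofReal (symDens a c s r) ≠ ⊤ := by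
      refine ne_top_of_le_ne_top fin (lintegral_mono_set Set.sdiff_subset)
    refine (ENNReal.add_le_add_iff_right fin2).mp ?_
    rw [← e1]
    gcongr

lemma sliceDens_swap (a c s t : ℝ) : sliceDens a c s (s - t) = sliceDens c a s t := by
  unfold sliceDens; rw [sub_sub_cancel, mul_comm]

lemma slice_compare {a c a' c' s t : ℝ} (ha' : 0 < a') (h1 : a' ≤ a) (h2 : a' ≤ c)
    (hsum : a + c = a' + c') (ht : 0 < t) :
    ∫⁻ r in Set.Icc t (s - t), ENNReal.ofReal (sliceDens a' c' s r)
      ≤ ∫⁻ r in Set.Icc t (s - t), ENNReal.ofReal (sliceDens a c s r) := by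
  rcases le_total a c with h | h
  · exact slice_compare_aux ha' h1 h hsum ht
  · refine (slice_compare_aux (c' := c') ha' h2 h (by linarith) ht).trans_eq ?_
    rw [← lintegral_reflect s t (s - t) _ (by ring)]
    simp_rw [sliceDens_swap]

/-- Normalised (up to `Γ(k)`) Dirichlet density in coordinates. -/
def nDens {n : ℕ} (a : Fin n → ℝ) (c : ℝ) (x : Fin n → ℝ) : ℝ :=
  (∏ i, (x i ^ (a i - 1) / Real.Gamma (a i))) * ((1 - ∑ i, x i) ^ (c - 1) / Real.Gamma c)

lemma measurable_nDens {n : ℕ} (a : Fin n → ℝ) (c : ℝ) : Measurable (nDens a c) := by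
  unfold nDens; fun_prop

/-- Open simplex in the plain function space. -/
def openT (n : ℕ) : Set (Fin n → ℝ) := {x | (∀ i, 0 < x i) ∧ ∑ i, x i < 1}

/-- Restricted simplex in the plain function space. -/
def clT (n : ℕ) (τ : ℝ) : Set (Fin n → ℝ) := {x | (∀ i, τ ≤ x i) ∧ τ ≤ 1 - ∑ i, x i}

lemma measurableSet_openT (n : ℕ) : MeasurableSet (openT n) := by
  unfold openT; measurability

lemma measurableSet_clT (n : ℕ) (τ : ℝ) : MeasurableSet (clT n τ) := by
  have h1 : MeasurableSet {x : Fin n → ℝ | ∀ i, τ ≤ x i} := by measurability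
  have h2 : MeasurableSet {x : Fin n → ℝ | τ ≤ 1 - ∑ i, x i} :=
    measurableSet_le (by fun_prop) (by fun_prop)
  exact h1.inter h2

lemma lintegral_slice {n : ℕ} (i : Fin (n + 1)) (a : Fin (n + 1) → ℝ) (c : ℝ)
    (U : Set (Fin (n + 1) → ℝ)) (hU : MeasurableSet U) (V : Set (Fin n → ℝ))
    (hV : MeasurableSet V) (I : (Fin n → ℝ) → Set ℝ) (hI : ∀ z, MeasurableSet (I z))
    (hz : ∀ z ∈ V, ∀ j, 0 ≤ z j) (hga : ∀ j, 0 < a j)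
    (h : ∀ t z, i.insertNth (α := fun _ => ℝ) t z ∈ U ↔ z ∈ V ∧ t ∈ I z) :
    ∫⁻ x in U, ENNReal.ofReal (nDens a c x) =
      ∫⁻ z in V, ENNReal.ofReal (∏ j, (z j ^ (a (i.succAbove j) - 1) / Real.Gamma (a (i.succAbove j))))
        * ∫⁻ t in I z, ENNReal.ofReal (sliceDens (a i) c (1 - ∑ j, z j) t) := by
  rw [← lintegral_indicator hU,
    ← ((volume_preserving_piFinSuccAbove (fun _ : Fin (n + 1) => ℝ) i).symm).lintegral_comp_emb
      (MeasurableEquiv.measurableEmbedding _)]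
  have hm : Measurable (U.indicator (fun x => ENNReal.ofReal (nDens a c x))) :=
    (measurable_nDens a c).ennreal_ofReal.indicator hU
  have hm2 : Measurable fun q : ℝ × (Fin n → ℝ) =>
      U.indicator (fun x => ENNReal.ofReal (nDens a c x))
        ((MeasurableEquiv.piFinSuccAbove (fun _ => ℝ) i).symm q) :=
    hm.comp (MeasurableEquiv.measurable _)
  rw [Measure.volume_eq_prod, lintegral_prod_symm' _ hm2,
    ← lintegral_indicator hV]
  refine lintegral_congr fun z => ?_
  by_cases hzV : z ∈ V
  · rw [Set.indicator_of_mem hzV, ← lintegral_const_mul _ (measurable_sliceDens _ _ _).ennreal_ofReal,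
      ← lintegral_indicator (hI z)]
    refine lintegral_congr fun t => ?_
    by_cases ht : t ∈ I z
    · have hq : (MeasurableEquiv.piFinSuccAbove (fun _ : Fin (n + 1) => ℝ) i).symm (t, z)
        = i.insertNth (α := fun _ => ℝ) t z := rfl
      rw [Set.indicator_of_mem ht, hq, Set.indicator_of_mem ((h t z).2 ⟨hzV, ht⟩),
        ← ENNReal.ofReal_mul (Finset.prod_nonneg fun j _ => div_nonneg
          (Real.rpow_nonneg (hz z hzV j) _) (Real.Gamma_pos_of_pos (hga _)).le)]
      congr 1
      unfold nDens sliceDens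
      rw [Fin.prod_univ_succAbove _ i, Fin.sum_univ_succAbove _ i]
      simp only [Fin.insertNth_apply_same, Fin.insertNth_apply_succAbove]
      rw [← sub_sub, sub_right_comm]
      ring
    · rw [Set.indicator_of_notMem ht, Set.indicator_of_notMem]
      exact fun hh => ht ((h t z).1 hh).2
  · rw [Set.indicator_of_notMem hzV]
    rw [lintegral_eq_zero_iff' (by
      exact (hm2.comp (measurable_id.prodMk measurable_const)).aemeasurable)]
    refine Filter.Eventually.of_forall fun t => ?_
    exact Set.indicator_of_notMem (fun hh => hzV ((h t z).1 hh).1) _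

lemma lintegral_nDens_openT : ∀ (n : ℕ) (a : Fin n → ℝ) (c : ℝ), (∀ i, 0 < a i) → 0 < c →
    ∫⁻ x in openT n, ENNReal.ofReal (nDens a c x)
      = ENNReal.ofReal (1 / Real.Gamma (c + ∑ i, a i)) := by
  intro n
  induction n with
  | zero =>
    intro a c _ hc
    have : openT 0 = Set.univ := by ext x; simp [openT]
    rw [this, Measure.restrict_univ, volume_pi, Measure.pi_of_empty _ 0, lintegral_dirac]
    simp [nDens]
  | succ n ih =>
    intro a c ha hc
    rw [lintegral_slice 0 a c (openT (n + 1)) (measurableSet_openT _) (openT n)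
      (measurableSet_openT _) (fun z => Set.Ioo 0 (1 - ∑ j, z j)) (fun z => measurableSet_Ioo)
      (fun z hz j => (hz.1 j).le) ha]
    · have e : ∀ z ∈ openT n,
        ENNReal.ofReal (∏ j, (z j ^ (a (Fin.succAbove 0 j) - 1) / Real.Gamma (a (Fin.succAbove 0 j))))
        * ∫⁻ t in Set.Ioo 0 (1 - ∑ j, z j), ENNReal.ofReal (sliceDens (a 0) c (1 - ∑ j, z j) t)
        = ENNReal.ofReal (nDens (fun j => a (Fin.succAbove 0 j)) (a 0 + c) z) := by
        intro z hz
        rw [lintegral_sliceDens (ha 0) hc (by linarith [hz.2]),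
          ← ENNReal.ofReal_mul (Finset.prod_nonneg fun j _ => div_nonneg
          (Real.rpow_nonneg (hz.1 j).le _) (Real.Gamma_pos_of_pos (ha _)).le)]
        rfl
      rw [setLIntegral_congr_fun (measurableSet_openT n) e, ih _ _ (fun j => ha _) (add_pos (ha 0) hc),
        Fin.sum_univ_succAbove a 0, ← add_assoc, add_comm (a 0) c]
    · intro t z
      simp only [openT, Set.mem_ofPred_eq, Fin.forall_iff_succAbove (0 : Fin (n+1)),
        Fin.sum_univ_succAbove _ (0 : Fin (n+1)), Fin.insertNth_apply_same,
        Fin.insertNth_apply_succAbove, Set.mem_Ioo]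
      constructor
      · rintro ⟨⟨h1, h2⟩, h3⟩
        exact ⟨⟨h2, by linarith⟩, h1, by linarith⟩
      · rintro ⟨⟨h2, h3⟩, h1, h4⟩
        exact ⟨⟨h1, h2⟩, by linarith⟩

lemma transfer {n : ℕ} (i : Fin n) (a a' : Fin n → ℝ) (c c' τ : ℝ) (hτ : 0 < τ)
    (ha : ∀ j, 0 < a j) (ha' : 0 < a' i) (h1 : a' i ≤ a i) (h2 : a' i ≤ c)
    (hsum : a i + c = a' i + c') (hne : ∀ j, j ≠ i → a' j = a j) :
    ∫⁻ x in clT n τ, ENNReal.ofReal (nDens a' c' x)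
      ≤ ∫⁻ x in clT n τ, ENNReal.ofReal (nDens a c x) := by
  obtain _ | n := n
  · exact i.elim0
  have hap : ∀ j, 0 < a' j := by
    intro j
    by_cases h : j = i
    · rw [h]; exact ha'
    · rw [hne j h]; exact ha j
  have hmem : ∀ t z, i.insertNth (α := fun _ => ℝ) t z ∈ clT (n + 1) τ ↔
      z ∈ {z : Fin n → ℝ | ∀ j, τ ≤ z j} ∧ t ∈ (fun z : Fin n → ℝ =>
        Set.Icc τ (1 - ∑ j, z j - τ)) z := by
    intro t z
    simp only [clT, Set.mem_ofPred_eq, Fin.forall_iff_succAbove i,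
        Fin.sum_univ_succAbove _ i, Fin.insertNth_apply_same,
        Fin.insertNth_apply_succAbove, Set.mem_Icc]
    constructor
    · rintro ⟨⟨h1, h2⟩, h3⟩
      exact ⟨h2, h1, by linarith⟩
    · rintro ⟨h2, h1, h4⟩
      exact ⟨⟨h1, h2⟩, by linarith⟩
  have hV : MeasurableSet {z : Fin n → ℝ | ∀ j, τ ≤ z j} := by measurability
  have hz : ∀ z ∈ {z : Fin n → ℝ | ∀ j, τ ≤ z j}, ∀ j, 0 ≤ z j := fun z h j => hτ.le.trans (h j)
  rw [lintegral_slice i a c _ (measurableSet_clT _ _) _ hV _ (fun z => measurableSet_Icc) hz ha hmem,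
    lintegral_slice i a' c' _ (measurableSet_clT _ _) _ hV _ (fun z => measurableSet_Icc) hz hap hmem]
  refine lintegral_mono fun z => ?_
  have e : ∀ j, a' (i.succAbove j) = a (i.succAbove j) := fun j => hne _ (Fin.succAbove_ne i j)
  simp only [e]
  refine mul_le_mul_right ?_ _
  exact slice_compare ha' h1 h2 hsum hτ

lemma transfer_all {n : ℕ} (a : Fin n → ℝ) (c τ e : ℝ) (hτ : 0 < τ) (he : 0 < e)
    (ha : ∀ j, e ≤ a j) (hc : e ≤ c) (s : Finset (Fin n)) :
    ∫⁻ x in clT n τ, ENNReal.ofReal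
        (nDens (fun j => if j ∈ s then e else a j) (c + ∑ j ∈ s, (a j - e)) x)
      ≤ ∫⁻ x in clT n τ, ENNReal.ofReal (nDens a c x) := by
  induction s using Finset.induction_on with
  | empty => simp
  | insert i s hi ih =>
    refine le_trans ?_ ih
    have hnn : 0 ≤ ∑ j ∈ s, (a j - e) := Finset.sum_nonneg fun j _ => by linarith [ha j]
    apply transfer i _ _ _ _ _ hτ
    · intro j; split_ifs
      · exact he
      · linarith [ha j]
    · simpa using he
    · simpa [hi] using ha i
    · rw [if_pos (Finset.mem_insert_self i s)]; linarith
    · rw [if_neg hi, if_pos (Finset.mem_insert_self i s), Finset.sum_insert hi]; ring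
    · intro j hj; simp [hj]

lemma gamma_lower {n : ℕ} (k : ℝ) (hk : 0 < k) (p : Fin (n + 1) → ℝ) (hp : ∀ i, 0 < p i)
    (hs : ∑ i, p i = 1) :
    ((n : ℝ) + 1) * Real.log (Real.Gamma (k / ((n : ℝ) + 1)))
      ≤ ∑ i, Real.log (Real.Gamma (k * p i)) := by
  have hn : (0 : ℝ) < (n : ℝ) + 1 := by positivity
  have := Real.convexOn_log_Gamma.map_sum_le (t := Finset.univ) (w := fun _ : Fin (n + 1) => 1 / ((n : ℝ) + 1))
    (p := fun i => k * p i) (fun i _ => by positivity) (by simp; field_simp)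
    (fun i _ => mul_pos hk (hp i))
  simp only [smul_eq_mul, Function.comp, ← Finset.mul_sum, hs] at this
  rw [show 1 / ((n : ℝ) + 1) * (k * 1) = k / ((n : ℝ) + 1) by ring] at this
  rw [one_div, inv_mul_eq_div, le_div_iff₀ hn] at this
  linarith

lemma gamma_upper {n : ℕ} (k η : ℝ) (hk : 0 < k) (hη : 0 < η) (hmη : ((n : ℝ) + 1) * η ≤ 1)
    (p : Fin (n + 1) → ℝ) (hp : ∀ i, η ≤ p i)
    (hs : ∑ i, p i = 1) :
    ∑ i, Real.log (Real.Gamma (k * p i)) ≤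
      (n : ℝ) * Real.log (Real.Gamma (k * η)) + Real.log (Real.Gamma (k * (1 - (n : ℝ) * η))) := by
  have hd : ∑ i, (p i - η) = 1 - ((n : ℝ) + 1) * η := by
    rw [Finset.sum_sub_distrib, hs]; simp
  rcases hmη.eq_or_lt with heq | hlt
  · have hz : ∀ i, p i = η := by
      have := (Finset.sum_eq_zero_iff_of_nonneg (s := Finset.univ) (f := fun i => p i - η)
        (fun i _ => by linarith [hp i])).1 (by rw [hd]; linarith)
      intro i
      linarith [this i (Finset.mem_univ i)]
    have : 1 - (n : ℝ) * η = η := by linarith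
    simp only [hz, this]
    simp
    linarith
  · set D := 1 - ((n : ℝ) + 1) * η with hD
    have hDpos : 0 < D := by rw [hD]; linarith
    have hM : 1 - (n : ℝ) * η = η + D := by rw [hD]; ring
    rw [hM]
    have hi : ∀ i, Real.log (Real.Gamma (k * p i)) ≤ (1 - (p i - η) / D) * Real.log (Real.Gamma (k * η))
        + (p i - η) / D * Real.log (Real.Gamma (k * (η + D))) := by
      intro i
      have h0 : 0 ≤ (p i - η) / D := div_nonneg (by linarith [hp i]) hDpos.le
      have h1 : (p i - η) / D ≤ 1 := by
        rw [div_le_one hDpos, ← hd]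
        exact Finset.single_le_sum (f := fun i => p i - η) (fun i _ => by linarith [hp i]) (Finset.mem_univ i)
      have := Real.convexOn_log_Gamma.2 (Set.mem_Ioi.2 (show 0 < k * η by positivity))
        (Set.mem_Ioi.2 (show 0 < k * (η + D) by positivity))
        (show 0 ≤ 1 - (p i - η) / D by linarith) h0 (by ring)
      simp only [smul_eq_mul, Function.comp] at this
      rwa [show (1 - (p i - η) / D) * (k * η) + (p i - η) / D * (k * (η + D)) = k * p i by
        field_simp; ring] at this
    refine (Finset.sum_le_sum fun i _ => hi i).trans_eq ?_
    rw [Finset.sum_add_distrib, ← Finset.sum_mul, ← Finset.sum_mul, Finset.sum_sub_distrib,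
      ← Finset.sum_div, hd, div_self hDpos.ne']
    simp

/-- First coordinates of the Dirichlet parameter. -/
def headPar {n : ℕ} (k : ℝ) (p : EuclideanSpace ℝ (Fin (n + 1))) : Fin n → ℝ :=
  fun i => k * p i.castSucc

lemma dirichletMeasure_apply (n : ℕ) (k : ℝ) (hk : 0 < k) (p : EuclideanSpace ℝ (Fin (n + 1)))
    (S : Set (EuclideanSpace ℝ (Fin n))) (hS : MeasurableSet S) :
    dirichletMeasure n k p S = ENNReal.ofReal (Real.Gamma k) *
      ∫⁻ x in (WithLp.toLp 2 ⁻¹' S) ∩ openT n,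
        ENNReal.ofReal (nDens (headPar k p) (k * p (Fin.last n)) x) := by
  have hgk := Real.Gamma_pos_of_pos hk
  unfold dirichletMeasure
  rw [withDensity_apply _ hS, Measure.restrict_restrict hS,
    ← (PiLp.volume_preserving_toLp (Fin n)).setLIntegral_comp_preimage_emb
      (MeasurableEquiv.toLp 2 (Fin n → ℝ)).measurableEmbedding,
    ← lintegral_const_mul _ (measurable_nDens _ _).ennreal_ofReal]
  refine lintegral_congr fun x => ?_
  rw [← ENNReal.ofReal_mul hgk.le]
  congr 1
  unfold nDens headPar
  rw [Fin.prod_univ_castSucc (fun i => Real.Gamma (k * p i)), Finset.prod_div_distrib]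
  ring

lemma dirichletMeasure_univ (n : ℕ) (k : ℝ) (hk : 0 < k) (p : EuclideanSpace ℝ (Fin (n + 1)))
    (hp : ∀ i, 0 < p i) (hs : ∑ i, p i = 1) : dirichletMeasure n k p Set.univ = 1 := by
  have hgk := Real.Gamma_pos_of_pos hk
  rw [dirichletMeasure_apply n k hk p _ MeasurableSet.univ, Set.preimage_univ, Set.univ_inter,
    lintegral_nDens_openT n (headPar k p) (k * p (Fin.last n)) (fun i => mul_pos hk (hp _))
      (mul_pos hk (hp _)),
    ← ENNReal.ofReal_mul hgk.le]
  have : k * p (Fin.last n) + ∑ i, headPar k p i = k := by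
    unfold headPar
    rw [← Finset.mul_sum, ← mul_add, add_comm, ← Fin.sum_univ_castSucc (fun i => p i), hs, mul_one]
  rw [this, mul_one_div_cancel hgk.ne', ENNReal.ofReal_one]

lemma clT_subset {n : ℕ} {τ : ℝ} (hτ : 0 < τ) : clT n τ ⊆ openT n :=
  fun _ hx => ⟨fun i => hτ.trans_le (hx.1 i), by linarith [hx.2]⟩

lemma preimage_restricted {n : ℕ} {τ : ℝ} (hτ : 0 < τ) :
    (WithLp.toLp 2 ⁻¹' restrictedSimplexCoord n τ) ∩ openT n = clT n τ := by
  ext x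
  constructor
  · rintro ⟨h, _⟩
    exact h.2
  · intro h
    exact ⟨⟨clT_subset hτ h, h⟩, clT_subset hτ h⟩

lemma measurableSet_restricted {n : ℕ} {τ : ℝ} (hτ : 0 < τ) :
    MeasurableSet (restrictedSimplexCoord n τ) := by
  have : restrictedSimplexCoord n τ = (MeasurableEquiv.toLp 2 (Fin n → ℝ)).symm ⁻¹' clT n τ := by
    ext x
    constructor
    · intro h
      exact h.2
    · intro h
      exact ⟨clT_subset hτ h, h⟩
  rw [this]
  exact (MeasurableEquiv.measurable _) (measurableSet_clT n τ)

lemma nDens_eq_exp {n : ℕ} (k : ℝ) (hk : 0 < k) (p : EuclideanSpace ℝ (Fin (n + 1)))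
    (hp : ∀ i, 0 < p i) (x : Fin n → ℝ) (hx : x ∈ openT n) :
    nDens (headPar k p) (k * p (Fin.last n)) x =
      Real.exp (∑ i, ((k * p i - 1) * Real.log (Fin.snoc (α := fun _ => ℝ) x (1 - ∑ j, x j) i)
        - Real.log (Real.Gamma (k * p i)))) := by
  have key : ∀ y q : ℝ, 0 < y → 0 < q → y ^ (k * q - 1) / Real.Gamma (k * q)
    = Real.exp ((k * q - 1) * Real.log y - Real.log (Real.Gamma (k * q))) := by
    intro y q hy hq
    rw [Real.exp_sub, Real.exp_log (Real.Gamma_pos_of_pos (mul_pos hk hq)),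
      Real.rpow_def_of_pos hy, mul_comm (Real.log y)]
  unfold nDens headPar
  rw [Real.exp_sum, Fin.prod_univ_castSucc]
  simp only [Fin.snoc_castSucc, Fin.snoc_last]
  rw [key _ _ (by linarith [hx.2]) (hp _)]
  congr 1
  exact Finset.prod_congr rfl fun i _ => key _ _ (hx.1 i) (hp _)

lemma sum_abs_le {m : ℕ} (v : EuclideanSpace ℝ (Fin m)) :
    ∑ i, |v i| ≤ Real.sqrt m * ‖v‖ := by
  rw [EuclideanSpace.norm_eq, ← Real.sqrt_mul (by positivity)]
  apply Real.le_sqrt_of_sq_le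
  have := sq_sum_le_card_mul_sum_sq (s := Finset.univ) (f := fun i => |v i|)
  simpa using this

lemma ratio_bound {n : ℕ} (k : ℝ) (hk : 0 < k) (η : ℝ) (hη : 0 < η)
    (hmη : ((n : ℝ) + 1) * η ≤ 1) (τ : ℝ) (hτ0 : 0 < τ) (hτ1 : τ < 1)
    (p q : EuclideanSpace ℝ (Fin (n + 1))) (hp : p ∈ restrictedSimplex (n + 1) η)
    (hq : q ∈ restrictedSimplex (n + 1) η) (B : ℝ) (hB : ‖p - q‖ ≤ B)
    (x : Fin n → ℝ) (hx : x ∈ clT n τ) :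
    nDens (headPar k p) (k * p (Fin.last n)) x ≤
      Real.exp (Real.sqrt ((n : ℝ) + 1) * B * k * Real.log (1 / τ)
                + (n : ℝ) * Real.log (Real.Gamma (k * η))
                + Real.log (Real.Gamma (k * (1 - (n : ℝ) * η)))
                - ((n : ℝ) + 1) * Real.log (Real.Gamma (k / ((n : ℝ) + 1)))) *
      nDens (headPar k q) (k * q (Fin.last n)) x := by
  have hxo := clT_subset hτ0 hx
  have hp0 : ∀ i, 0 < p i := fun i => hη.trans_le (hp.2 i)
  have hq0 : ∀ i, 0 < q i := fun i => hη.trans_le (hq.2 i)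
  rw [nDens_eq_exp k hk p hp0 x hxo, nDens_eq_exp k hk q hq0 x hxo, ← Real.exp_add,
    Real.exp_le_exp]
  set y : Fin (n + 1) → ℝ := Fin.snoc (α := fun _ => ℝ) x (1 - ∑ j, x j) with hy
  have hyτ : ∀ i, τ ≤ y i := by
    intro i
    refine Fin.lastCases ?_ (fun j => ?_) i
    · simpa [hy] using hx.2
    · simpa [hy] using hx.1 j
  have hysum : ∑ i, y i = 1 := by
    rw [Fin.sum_univ_castSucc]; simp [hy]
  have hy1 : ∀ i, y i ≤ 1 := by
    intro i
    rw [← hysum]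
    exact Finset.single_le_sum (f := y) (fun j _ => hτ0.le.trans (hyτ j)) (Finset.mem_univ i)
  have hlow := gamma_lower k hk (fun i => p i) hp0 hp.1
  have hupp := gamma_upper k η hk hη hmη (fun i => q i) hq.2 hq.1
  have hlogτ : 0 ≤ Real.log (1 / τ) := Real.log_nonneg (by rw [le_div_iff₀ hτ0]; linarith)
  have hterm : ∀ i, k * (p i - q i) * Real.log (y i) ≤ k * Real.log (1 / τ) * |(p - q) i| := by
    intro i
    have h1 : |Real.log (y i)| ≤ Real.log (1 / τ) := by
      rw [abs_of_nonpos (Real.log_nonpos (hτ0.le.trans (hyτ i)) (hy1 i)), one_div, Real.log_inv]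
      exact neg_le_neg (Real.log_le_log hτ0 (hyτ i))
    have h2 : (p i - q i) * Real.log (y i) ≤ |p i - q i| * Real.log (1 / τ) := by
      refine (le_abs_self _).trans ?_
      rw [abs_mul]
      gcongr
    have h3 := mul_le_mul_of_nonneg_left h2 hk.le
    have h4 : (p - q) i = p i - q i := rfl
    rw [h4]
    linarith
  have hsum : ∑ i, k * (p i - q i) * Real.log (y i)
      ≤ Real.sqrt ((n : ℝ) + 1) * B * k * Real.log (1 / τ) := by
    refine (Finset.sum_le_sum fun i _ => hterm i).trans ?_
    rw [← Finset.mul_sum]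
    have h5 := sum_abs_le (p - q)
    push_cast at h5
    have h6 : ∑ i, |(p - q) i| ≤ Real.sqrt ((n : ℝ) + 1) * B :=
      h5.trans (mul_le_mul_of_nonneg_left hB (Real.sqrt_nonneg _))
    have := mul_le_mul_of_nonneg_left h6 (mul_nonneg hk.le hlogτ)
    linarith
  have hexp : ∑ i, ((k * p i - 1) * Real.log (y i) - Real.log (Real.Gamma (k * p i)))
      = ∑ i, k * (p i - q i) * Real.log (y i)
        + ∑ i, ((k * q i - 1) * Real.log (y i) - Real.log (Real.Gamma (k * q i)))
        + ∑ i, Real.log (Real.Gamma (k * q i)) - ∑ i, Real.log (Real.Gamma (k * p i)) := by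
    rw [← Finset.sum_add_distrib, ← Finset.sum_add_distrib, ← Finset.sum_sub_distrib]
    exact Finset.sum_congr rfl fun i _ => by ring
  rw [hexp]
  linarith

lemma pstar_compare {n : ℕ} (k : ℝ) (hk : 0 < k) (η : ℝ) (hη : 0 < η) (τ : ℝ) (hτ0 : 0 < τ)
    (p : EuclideanSpace ℝ (Fin (n + 1))) (hp : p ∈ restrictedSimplex (n + 1) η) :
    dirichletMeasure n k (pstar n η) (restrictedSimplexCoord n τ) ≤
      dirichletMeasure n k p (restrictedSimplexCoord n τ) := by
  rw [dirichletMeasure_apply n k hk _ _ (measurableSet_restricted hτ0),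
    dirichletMeasure_apply n k hk _ _ (measurableSet_restricted hτ0), preimage_restricted hτ0]
  refine mul_le_mul_right ?_ _
  have := transfer_all (headPar k p) (k * p (Fin.last n)) τ (k * η) hτ0 (mul_pos hk hη)
    (fun j => mul_le_mul_of_nonneg_left (hp.2 _) hk.le) (mul_le_mul_of_nonneg_left (hp.2 _) hk.le)
    Finset.univ
  have e1 : headPar k (pstar n η) = fun j : Fin n => if j ∈ Finset.univ then k * η else headPar k p j := by
    funext j
    simp [headPar, pstar, (Fin.castSucc_lt_last j).ne]
  have e2 : k * (pstar n η) (Fin.last n)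
      = k * p (Fin.last n) + ∑ j, (headPar k p j - k * η) := by
    have h1 := hp.1
    rw [Fin.sum_univ_castSucc] at h1
    have h2 : (pstar n η) (Fin.last n) = 1 - n * η := by simp [pstar]
    rw [h2, Finset.sum_sub_distrib]
    unfold headPar
    rw [← Finset.mul_sum, ← h1]
    simp
    ring
  rw [e1, e2]
  exact this

/-- the composition of the Dirichlet mechanism Dir_k with an L-Lipschitz
map f into Δ_{m,η} is (ε,δ)-differentially private for b-adjacent inputs, with m = n+1,
ε = √m·L·b·k·log(1/τ) + (m−1)·log Γ(kη) + log Γ(k(1−(m−1)η)) − m·log Γ(k/m) and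
δ = 1 − μ_{k,p*}(S_τ). -/
theorem dirichlet_mechanism_composition_differentially_private
    (n d : ℕ) (hn : 1 ≤ n) (hd : 1 ≤ d) (k : ℝ) (hk : 0 < k)
    (η : ℝ) (hη : 0 < η) (hmη : ((n : ℝ) + 1) * η ≤ 1)
    (τ : ℝ) (hτ0 : 0 < τ) (hτ1 : τ < 1)
    (b L : ℝ) (hb : 0 ≤ b) (hL : 0 ≤ L)
    (f : EuclideanSpace ℝ (Fin d) → EuclideanSpace ℝ (Fin (n+1)))
    (hfLip : ∀ X Y, ‖f X - f Y‖ ≤ L * ‖X - Y‖)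
    (hfmem : ∀ X, f X ∈ restrictedSimplex (n+1) η) :
    ∀ X X' : EuclideanSpace ℝ (Fin d), ‖X - X'‖ ≤ b →
      ∀ S : Set (EuclideanSpace ℝ (Fin n)), MeasurableSet S →
        dirichletMeasure n k (f X) S ≤
          ENNReal.ofReal (Real.exp
              (Real.sqrt ((n : ℝ) + 1) * L * b * k * Real.log (1 / τ)
                + (n : ℝ) * Real.log (Real.Gamma (k * η))
                + Real.log (Real.Gamma (k * (1 - (n : ℝ) * η)))
                - ((n : ℝ) + 1) * Real.log (Real.Gamma (k / ((n : ℝ) + 1))))) *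
            dirichletMeasure n k (f X') S
          + (1 - dirichletMeasure n k (pstar n η) (restrictedSimplexCoord n τ)) := by
  intro X X' hXX S hS
  have hp := hfmem X
  have hq := hfmem X'
  have hR := measurableSet_restricted (n := n) hτ0
  have hp0 : ∀ i, 0 < f X i := fun i => hη.trans_le (hp.2 i)
  have huniv := dirichletMeasure_univ n k hk (f X) hp0 hp.1
  haveI : IsProbabilityMeasure (dirichletMeasure n k (f X)) := ⟨huniv⟩
  have hB : ‖f X - f X'‖ ≤ L * b :=
    (hfLip X X').trans (mul_le_mul_of_nonneg_left hXX hL)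
  have h1 : dirichletMeasure n k (f X) S ≤
      dirichletMeasure n k (f X) (S ∩ restrictedSimplexCoord n τ)
      + dirichletMeasure n k (f X) (restrictedSimplexCoord n τ)ᶜ := by
    refine (measure_mono ?_).trans (measure_union_le _ _)
    intro x hx
    by_cases h : x ∈ restrictedSimplexCoord n τ
    · exact Or.inl ⟨hx, h⟩
    · exact Or.inr h
  refine h1.trans (add_le_add ?_ ?_)
  · refine le_trans ?_ (mul_le_mul_right (measure_mono (Set.inter_subset_left
      (t := restrictedSimplexCoord n τ))) _)
    have hset : (WithLp.toLp 2 ⁻¹' (S ∩ restrictedSimplexCoord n τ)) ∩ openT n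
        = (WithLp.toLp 2 ⁻¹' S) ∩ clT n τ := by
      rw [Set.preimage_inter, Set.inter_assoc, preimage_restricted hτ0]
    have hSm : MeasurableSet ((WithLp.toLp 2 ⁻¹' S : Set (Fin n → ℝ)) ∩ clT n τ) :=
      ((MeasurableEquiv.toLp 2 (Fin n → ℝ)).measurable hS).inter (measurableSet_clT n τ)
    rw [dirichletMeasure_apply n k hk _ _ (hS.inter hR),
      dirichletMeasure_apply n k hk _ _ (hS.inter hR), hset, mul_left_comm]
    refine mul_le_mul_right ?_ _
    rw [← lintegral_const_mul _ (measurable_nDens _ _).ennreal_ofReal]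
    refine setLIntegral_mono ((measurable_nDens _ _).ennreal_ofReal.const_mul _) ?_
    intro x hx
    rw [← ENNReal.ofReal_mul (Real.exp_pos _).le]
    apply ENNReal.ofReal_le_ofReal
    have := ratio_bound k hk η hη hmη τ hτ0 hτ1 (f X) (f X') hp hq (L * b) hB x hx.2
    rwa [← mul_assoc (Real.sqrt ((n : ℝ) + 1)) L b] at this
  · rw [prob_compl_eq_one_sub hR]
    exact tsub_le_tsub_left (pstar_compare k hk η hη τ hτ0 (f X) hp) 1

end
end

section
/- Let m ≥ 2, k > 0, 0 < η with m·η ≤ 1, and τ > 0. Then for every p ∈ Δ_{m,η}, the Dirichlet probability of the τ-restricted simplex is minimized at the vertex p*: μ_{k,p}(S_τ) ≥ μ_{k,p*}(S_τ). -/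
open MeasureTheory

noncomputable section

lemma aux_cosh_abs_le {a b : ℝ} (h : |a| ≤ |b|) : Real.cosh a ≤ Real.cosh b :=
  Real.cosh_le_cosh.2 h

lemma aux_cosh_mul (p q t u : ℝ) (hp : |p| ≤ q) (hu : |t| ≤ u) :
    Real.cosh (q * t) * Real.cosh (p * u) ≤ Real.cosh (p * t) * Real.cosh (q * u) := by
  have key : ∀ a b : ℝ, Real.cosh a * Real.cosh b =
      (Real.cosh (a + b) + Real.cosh (a - b)) / 2 := by
    intro a b; rw [Real.cosh_add, Real.cosh_sub]; ring
  -- reduce to nonnegative values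
  have hq : |q| = q := abs_of_nonneg ((abs_nonneg p).trans hp)
  have hu' : |u| = u := abs_of_nonneg ((abs_nonneg t).trans hu)
  rw [← Real.cosh_abs (q * t), ← Real.cosh_abs (p * u), ← Real.cosh_abs (p * t),
    abs_mul, abs_mul, abs_mul, hq, hu']
  have h1 := abs_nonneg p
  have h2 := abs_nonneg t
  generalize |p| = p at *
  generalize |t| = t at *
  rw [key, key]
  have e1 : Real.cosh (q * t + p * u) ≤ Real.cosh (p * t + q * u) := by
    apply aux_cosh_abs_le
    rw [abs_of_nonneg (by nlinarith [mul_nonneg (h1.trans hp) h2, mul_nonneg h1 (h2.trans hu)])]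
    refine le_trans ?_ (le_abs_self _)
    nlinarith [mul_nonneg (sub_nonneg.2 hp) (sub_nonneg.2 hu)]
  have e2 : Real.cosh (q * t - p * u) ≤ Real.cosh (p * t - q * u) := by
    apply aux_cosh_abs_le
    refine le_trans ?_ (neg_le_abs _)
    rw [abs_le]
    constructor <;> nlinarith [mul_nonneg (sub_nonneg.2 hp) h2, mul_nonneg (sub_nonneg.2 hp) (h2.trans hu), mul_nonneg (sub_nonneg.2 hu) h1, mul_nonneg (sub_nonneg.2 hu) (h1.trans hp)]
  linarith

lemma aux_sym (a b x y : ℝ) (hx : 0 < x) (hy : 0 < y) :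
    x ^ (a - 1) * y ^ (b - 1) + x ^ (b - 1) * y ^ (a - 1) =
      2 * (x * y) ^ ((a + b) / 2 - 1) *
        Real.cosh ((b - a) / 2 * (Real.log y - Real.log x)) := by
  rw [Real.cosh_eq, Real.rpow_def_of_pos (mul_pos hx hy), Real.log_mul hx.ne' hy.ne',
    Real.rpow_def_of_pos hx, Real.rpow_def_of_pos hx, Real.rpow_def_of_pos hy,
    Real.rpow_def_of_pos hy]
  rw [mul_div_assoc', mul_comm 2, mul_assoc, mul_comm 2, mul_div_assoc, mul_div_assoc,
    div_self two_ne_zero, mul_one, mul_add, ← Real.exp_add, ← Real.exp_add, ← Real.exp_add,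
    ← Real.exp_add]
  ring_nf

/-- symmetrised kernel -/
def auxH (a b s x : ℝ) : ℝ := x ^ (a - 1) * (s - x) ^ (b - 1) + x ^ (b - 1) * (s - x) ^ (a - 1)

lemma auxH_ratio (a b a' b' s x y : ℝ) (hsum : a' + b' = a + b) (ha : a' ≤ a) (hb : a' ≤ b)
    (hx : 0 < x) (hxs : x < s) (hy : 0 < y) (hys : y < s) 
    (hxy : |Real.log (s - x) - Real.log x| ≤ |Real.log (s - y) - Real.log y|) :
    auxH a' b' s x * auxH a b s y ≤ auxH a b s x * auxH a' b' s y := by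
  unfold auxH
  rw [aux_sym _ _ _ _ hx (sub_pos.2 hxs), aux_sym _ _ _ _ hx (sub_pos.2 hxs),
    aux_sym _ _ _ _ hy (sub_pos.2 hys), aux_sym _ _ _ _ hy (sub_pos.2 hys), hsum]
  have h := aux_cosh_mul ((b - a) / 2) ((b' - a') / 2) (Real.log (s - x) - Real.log x)
    |Real.log (s - y) - Real.log y| (by rw [abs_le]; constructor <;> linarith) hxy
  have e : ∀ r : ℝ, Real.cosh (r * |Real.log (s - y) - Real.log y|) =
      Real.cosh (r * (Real.log (s - y) - Real.log y)) := by
    intro r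
    rw [← Real.cosh_abs, abs_mul, abs_abs, ← abs_mul, Real.cosh_abs]
  rw [e, e] at h
  have hX : 0 ≤ (x * (s - x)) ^ ((a + b) / 2 - 1) :=
    Real.rpow_nonneg (mul_nonneg hx.le (sub_pos.2 hxs).le) _
  have hY : 0 ≤ (y * (s - y)) ^ ((a + b) / 2 - 1) :=
    Real.rpow_nonneg (mul_nonneg hy.le (sub_pos.2 hys).le) _
  have := mul_le_mul_of_nonneg_left h (mul_nonneg hX hY)
  linarith

lemma auxH_pos (a b s x : ℝ) (hx : 0 < x) (hxs : x < s) : 0 < auxH a b s x := by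
  have := sub_pos.2 hxs
  unfold auxH; positivity

lemma aux_log_in (s τ x : ℝ) (hτ : 0 < τ) (h1 : τ ≤ x) (h2 : x ≤ s - τ) :
    |Real.log (s - x) - Real.log x| ≤ |Real.log (s - τ) - Real.log τ| := by
  refine le_trans ?_ (le_abs_self _)
  have l1 := Real.log_le_log hτ h1
  have l2 := Real.log_le_log (hτ.trans_le h1) h2
  have l3 := Real.log_le_log hτ (by linarith : τ ≤ s - x)
  have l4 := Real.log_le_log (by linarith : 0 < s - x) (by linarith : s - x ≤ s - τ)
  rw [abs_le]; constructor <;> linarith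

lemma aux_log_out (s τ x : ℝ) (hτ : 0 < τ) (hs : τ ≤ s - τ) (hx : 0 < x) (hxs : x < s)
    (h : ¬ (τ ≤ x ∧ x ≤ s - τ)) :
    |Real.log (s - τ) - Real.log τ| ≤ |Real.log (s - x) - Real.log x| := by
  rw [abs_of_nonneg (sub_nonneg.2 (Real.log_le_log hτ hs))]
  by_cases h1 : τ ≤ x
  · have h2 : s - τ < x := by by_contra h2; exact h ⟨h1, by linarith⟩
    refine le_trans ?_ (neg_le_abs _)
    have l1 := Real.log_le_log (by linarith : 0 < s - τ) h2.le
    have l2 := Real.log_le_log (by linarith : 0 < s - x) (by linarith : s - x ≤ τ)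
    linarith
  · refine le_trans ?_ (le_abs_self _)
    have l1 := Real.log_le_log hx (by linarith : x ≤ τ)
    have l2 := Real.log_le_log (by linarith : 0 < s - τ) (by linarith : s - τ ≤ s - x)
    linarith

/-- unnormalised beta kernel on `(0,s)` -/
def auxF (a b s x : ℝ) : ENNReal := ENNReal.ofReal (x ^ (a - 1) * (s - x) ^ (b - 1))

@[fun_prop]
lemma auxF_meas (a b s : ℝ) : Measurable (auxF a b s) := by
  unfold auxF; fun_prop

lemma auxF_refl (a b s x : ℝ) : auxF a b s (s - x) = auxF b a s x := by
  unfold auxF; rw [sub_sub_cancel, mul_comm]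

lemma auxF_total (a b s : ℝ) (ha : 0 < a) (hb : 0 < b) (hs : 0 < s) :
    ∫⁻ x in Set.Ioo 0 s, auxF a b s x =
      ENNReal.ofReal (s ^ (a + b - 1) * ProbabilityTheory.beta a b) := by
  rw [← lintegral_indicator measurableSet_Ioo, ← Real.smul_map_volume_mul_left hs.ne',
    lintegral_smul_measure, lintegral_map ((auxF_meas a b s).indicator measurableSet_Ioo)
      (by fun_prop)]
  have : ∀ u, (Set.Ioo 0 s).indicator (auxF a b s) (s * u) =
      ENNReal.ofReal (s ^ (a + b - 2) * ProbabilityTheory.beta a b) *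
        ProbabilityTheory.betaPDF a b u := by
    intro u
    have hB := ProbabilityTheory.beta_pos ha hb
    by_cases hu : 0 < u ∧ u < 1
    · have hm : s * u ∈ Set.Ioo 0 s := ⟨mul_pos hs hu.1, by nlinarith⟩
      have : 0 < 1 - u := by linarith
      rw [Set.indicator_of_mem hm, ProbabilityTheory.betaPDF_of_pos_lt_one hu.1 hu.2, auxF,
        ← ENNReal.ofReal_mul (by positivity)]
      congr 1
      rw [show s - s * u = s * (1 - u) by ring, Real.mul_rpow hs.le hu.1.le,
        Real.mul_rpow hs.le (by linarith), show a + b - 2 = (a - 1) + (b - 1) by ring,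
        Real.rpow_add hs]
      field_simp
    · have hm : s * u ∉ Set.Ioo 0 s := by
        rintro ⟨h1, h2⟩
        exact hu ⟨pos_of_mul_pos_right h1 hs.le, by nlinarith⟩
      rw [Set.indicator_of_notMem hm, ProbabilityTheory.betaPDF_eq, if_neg hu]; simp
  simp_rw [this]
  rw [lintegral_const_mul _ (by unfold ProbabilityTheory.betaPDF; fun_prop), ProbabilityTheory.lintegral_betaPDF_eq_one ha hb, mul_one,
    abs_of_pos hs, smul_eq_mul, ← ENNReal.ofReal_mul hs.le, ← mul_assoc]
  congr 2
  rw [show a + b - 1 = 1 + (a + b - 2) by ring, Real.rpow_add hs, Real.rpow_one]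

lemma auxF_set_refl (a b s : ℝ) (A : Set ℝ) (hA : MeasurableSet A)
    (hsym : ∀ x, s - x ∈ A ↔ x ∈ A) :
    ∫⁻ x in A, auxF a b s x = ∫⁻ x in A, auxF b a s x := by
  rw [← lintegral_indicator hA, ← lintegral_indicator hA, ← lintegral_sub_left_eq_self _ s]
  congr 1; ext x
  by_cases hx : x ∈ A
  · rw [Set.indicator_of_mem hx, Set.indicator_of_mem ((hsym x).2 hx), auxF_refl]
  · rw [Set.indicator_of_notMem hx, Set.indicator_of_notMem (fun h => hx ((hsym x).1 h))]

lemma auxH_set (a b s : ℝ) (A : Set ℝ) (hA : MeasurableSet A) (hA0 : A ⊆ Set.Ioo 0 s)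
    (hsym : ∀ x, s - x ∈ A ↔ x ∈ A) :
    ∫⁻ x in A, ENNReal.ofReal (auxH a b s x) = 2 * ∫⁻ x in A, auxF a b s x := by
  rw [two_mul]
  nth_rewrite 2 [auxF_set_refl a b s A hA hsym]
  rw [← lintegral_add_left (by fun_prop)]
  refine setLIntegral_congr_fun hA fun x hx => ?_
  have h1 := (hA0 hx).1
  have h2 := sub_pos.2 (hA0 hx).2
  simp only [auxH, auxF]
  rw [ENNReal.ofReal_add (by positivity) (by positivity)]

/-- The one-dimensional inequality. -/
lemma aux_one_dim (a b a' b' s τ : ℝ) (hsum : a' + b' = a + b) (ha0 : 0 < a')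
    (ha : a' ≤ a) (hb : a' ≤ b) (hτ : 0 < τ) :
    (∫⁻ x in Set.Icc τ (s - τ), auxF a' b' s x) * ENNReal.ofReal (Real.Gamma a * Real.Gamma b) ≤
    (∫⁻ x in Set.Icc τ (s - τ), auxF a b s x) *
      ENNReal.ofReal (Real.Gamma a' * Real.Gamma b') := by
  by_cases hs : τ ≤ s - τ
  swap
  · rw [Set.Icc_eq_empty hs]; simp
  have hs0 : 0 < s := by linarith
  set A := Set.Icc τ (s - τ) with hAdef
  set B := Set.Ioo 0 s \ A with hBdef
  have hA : MeasurableSet A := measurableSet_Icc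
  have hB : MeasurableSet B := measurableSet_Ioo.diff hA
  have hA0 : A ⊆ Set.Ioo 0 s := fun x hx => ⟨hτ.trans_le hx.1, by linarith [hx.2]⟩
  have hAs : ∀ x, s - x ∈ A ↔ x ∈ A := by
    intro x; simp only [hAdef, Set.mem_Icc]; constructor <;> rintro ⟨_, _⟩ <;> constructor <;> linarith
  have hBs : ∀ x, s - x ∈ B ↔ x ∈ B := by
    intro x
    simp only [hBdef, Set.mem_sdiff, hAs, Set.mem_Ioo]
    constructor <;> rintro ⟨⟨_, _⟩, h⟩ <;> refine ⟨⟨?_, ?_⟩, h⟩ <;> linarith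
  have hτs : τ < s := by linarith
  have split : ∀ a b : ℝ, 0 < a → 0 < b → (∫⁻ x in A, auxF a b s x) + (∫⁻ x in B, auxF a b s x) =
      ENNReal.ofReal (s ^ (a + b - 1) * ProbabilityTheory.beta a b) := by
    intro a b ha hb
    rw [← auxF_total a b s ha hb hs0, ← lintegral_inter_add_sdiff _ (Set.Ioo 0 s) hA,
      Set.inter_eq_right.2 hA0]
  set c := auxH a' b' s τ / auxH a b s τ with hc
  have hp := auxH_pos a b s τ hτ hτs
  have hp' := auxH_pos a' b' s τ hτ hτs
  have hc0 : 0 < c := div_pos hp' hp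
  have hIA : ∫⁻ x in A, auxF a' b' s x ≤ ENNReal.ofReal c * ∫⁻ x in A, auxF a b s x := by
    have : (2 : ENNReal) * ∫⁻ x in A, auxF a' b' s x ≤
        2 * (ENNReal.ofReal c * ∫⁻ x in A, auxF a b s x) := by
      rw [mul_left_comm, ← auxH_set _ _ _ _ hA (hA0) hAs, ← auxH_set _ _ _ _ hA (hA0) hAs,
        ← lintegral_const_mul' _ _ ENNReal.ofReal_ne_top]
      refine setLIntegral_mono' hA fun x hx => ?_
      rw [← ENNReal.ofReal_mul hc0.le]
      apply ENNReal.ofReal_le_ofReal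
      rw [hc, div_mul_eq_mul_div, le_div_iff₀ hp, mul_comm (auxH a' b' s τ)]
      exact auxH_ratio a b a' b' s x τ hsum ha hb (hA0 hx).1 (hA0 hx).2 hτ hτs
        (aux_log_in s τ x hτ hx.1 hx.2)
    exact (ENNReal.mul_le_mul_iff_right (by simp) (by simp)).1 this
  have hIB : ENNReal.ofReal c * ∫⁻ x in B, auxF a b s x ≤ ∫⁻ x in B, auxF a' b' s x := by
    have hB0 : B ⊆ Set.Ioo 0 s := Set.sdiff_subset
    have : 2 * (ENNReal.ofReal c * ∫⁻ x in B, auxF a b s x) ≤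
        (2 : ENNReal) * ∫⁻ x in B, auxF a' b' s x := by
      rw [mul_left_comm, ← auxH_set _ _ _ _ hB (hB0) hBs, ← auxH_set _ _ _ _ hB (hB0) hBs,
        ← lintegral_const_mul' _ _ ENNReal.ofReal_ne_top]
      refine setLIntegral_mono' hB fun x hx => ?_
      rw [← ENNReal.ofReal_mul hc0.le]
      apply ENNReal.ofReal_le_ofReal
      rw [hc, div_mul_eq_mul_div, div_le_iff₀ hp, mul_comm (auxH a' b' s x)]
      exact auxH_ratio a b a' b' s τ x hsum ha hb hτ hτs (hB0 hx).1 (hB0 hx).2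
        (aux_log_out s τ x hτ hs (hB0 hx).1 (hB0 hx).2 hx.2)
    exact (ENNReal.mul_le_mul_iff_right (by simp) (by simp)).1 this
  have h0 := split a b (by linarith) (by linarith)
  have h1 := split a' b' (by linarith) (by linarith)
  have main : (∫⁻ x in A, auxF a' b' s x) *
      ENNReal.ofReal (s ^ (a + b - 1) * ProbabilityTheory.beta a b) ≤
      (∫⁻ x in A, auxF a b s x) *
      ENNReal.ofReal (s ^ (a' + b' - 1) * ProbabilityTheory.beta a' b') := by
    rw [← h0, ← h1, mul_add, mul_add, mul_comm (∫⁻ x in A, auxF a' b' s x) (∫⁻ x in A, auxF a b s x)]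
    gcongr 1
    calc _ ≤ (ENNReal.ofReal c * ∫⁻ x in A, auxF a b s x) * ∫⁻ x in B, auxF a b s x := by gcongr
      _ = (∫⁻ x in A, auxF a b s x) * (ENNReal.ofReal c * ∫⁻ x in B, auxF a b s x) := by ring
      _ ≤ _ := by gcongr
  rw [hsum] at main
  have hG : 0 < Real.Gamma (a + b) := Real.Gamma_pos_of_pos (by linarith)
  have hcst : 0 < s ^ (a + b - 1) / Real.Gamma (a + b) := div_pos (Real.rpow_pos_of_pos hs0 _) hG
  unfold ProbabilityTheory.beta at main
  rw [hsum, mul_div_assoc', mul_div_assoc', ← div_mul_eq_mul_div, ← div_mul_eq_mul_div,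
    ENNReal.ofReal_mul hcst.le, ENNReal.ofReal_mul hcst.le, mul_left_comm,
    mul_left_comm (∫⁻ x in A, auxF a b s x)] at main
  exact (ENNReal.mul_le_mul_iff_right (by simpa using hcst) (by simp)).1 main

/-- The region in plain coordinates. -/
def auxS (n : ℕ) (τ : ℝ) : Set (Fin n → ℝ) := {x | (∀ i, τ ≤ x i) ∧ τ ≤ 1 - ∑ i, x i}

lemma auxS_meas (n : ℕ) (τ : ℝ) : MeasurableSet (auxS n τ) := by
  unfold auxS
  apply MeasurableSet.inter
  · change MeasurableSet {x : Fin n → ℝ | ∀ i, τ ≤ x i}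
    simp only [Set.ofPred_forall]
    exact MeasurableSet.iInter fun i => measurableSet_le (by fun_prop) (by fun_prop)
  · change MeasurableSet {x : Fin n → ℝ | τ ≤ 1 - ∑ i, x i}
    exact measurableSet_le (by fun_prop) (by fun_prop)

/-- The density, extended by zero off the region. -/
def auxDens (n : ℕ) (k τ : ℝ) (w : Fin n → ℝ) : (Fin n → ℝ) → ENNReal :=
  (auxS n τ).indicator fun x => ENNReal.ofReal (Real.Gamma k *
      (∏ i : Fin n, (x i) ^ (k * w i - 1)) *
      (1 - ∑ i, x i) ^ (k * (1 - ∑ i, w i) - 1) /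
      ((∏ i, Real.Gamma (k * w i)) * Real.Gamma (k * (1 - ∑ i, w i))))

lemma auxDens_meas (n : ℕ) (k τ : ℝ) (w : Fin n → ℝ) : Measurable (auxDens n k τ w) := by
  unfold auxDens
  refine Measurable.indicator ?_ (auxS_meas n τ)
  fun_prop

/-- The factor not depending on coordinate `i`. -/
def auxK (n : ℕ) (k : ℝ) (i : Fin n) (w x : Fin n → ℝ) : ℝ :=
  Real.Gamma k * (∏ j ∈ Finset.univ.erase i, (x j) ^ (k * w j - 1)) /
    ∏ j ∈ Finset.univ.erase i, Real.Gamma (k * w j)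

lemma aux_sum_update (n : ℕ) (i : Fin n) (x : Fin n → ℝ) (t : ℝ) :
    ∑ j, Function.update x i t j = t + ∑ j ∈ Finset.univ.erase i, x j := by
  rw [← Finset.add_sum_erase _ _ (Finset.mem_univ i), Function.update_self]
  congr 1
  refine Finset.sum_congr rfl fun j hj => ?_
  rw [Function.update_of_ne (Finset.ne_of_mem_erase hj)]

lemma auxDens_update (n : ℕ) (k τ : ℝ) (hk : 0 < k) (hτ : 0 < τ) (w : Fin n → ℝ)
    (hw : ∀ j, 0 < w j) (hw1 : ∑ j, w j < 1) (i : Fin n) (x : Fin n → ℝ)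
    (hx : ∀ j, j ≠ i → τ ≤ x j) (t : ℝ) :
    auxDens n k τ w (Function.update x i t) = ENNReal.ofReal (auxK n k i w x) *
      (ENNReal.ofReal (Real.Gamma (k * w i) * Real.Gamma (k * (1 - ∑ j, w j))))⁻¹ *
      (Set.Icc τ ((1 - ∑ j ∈ Finset.univ.erase i, x j) - τ)).indicator
        (auxF (k * w i) (k * (1 - ∑ j, w j)) (1 - ∑ j ∈ Finset.univ.erase i, x j)) t := by
  have hG : ∀ j, 0 < Real.Gamma (k * w j) := fun j => Real.Gamma_pos_of_pos (mul_pos hk (hw j))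
  have hG' : 0 < Real.Gamma (k * (1 - ∑ j, w j)) :=
    Real.Gamma_pos_of_pos (mul_pos hk (by linarith))
  unfold auxDens
  by_cases ht : t ∈ Set.Icc τ ((1 - ∑ j ∈ Finset.univ.erase i, x j) - τ)
  · have hm : Function.update x i t ∈ auxS n τ := by
      refine ⟨fun j => ?_, ?_⟩
      · by_cases hj : j = i
        · subst hj; rw [Function.update_self]; exact ht.1
        · rw [Function.update_of_ne hj]; exact hx j hj
      · rw [aux_sum_update]; linarith [ht.2]
    have hK : 0 ≤ auxK n k i w x := by
      refine div_nonneg (mul_nonneg (Real.Gamma_pos_of_pos hk).le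
        (Finset.prod_nonneg fun j hj => Real.rpow_nonneg ?_ _))
        (Finset.prod_nonneg fun j hj => (hG j).le)
      exact hτ.le.trans (hx j (Finset.ne_of_mem_erase hj))
    rw [Set.indicator_of_mem hm, Set.indicator_of_mem ht, auxF,
      ← ENNReal.ofReal_inv_of_pos (mul_pos (hG i) hG'), ← ENNReal.ofReal_mul hK,
      ← ENNReal.ofReal_mul (mul_nonneg hK (inv_nonneg.2 (mul_pos (hG i) hG').le))]
    congr 1
    rw [aux_sum_update, ← Finset.mul_prod_erase _ _ (Finset.mem_univ i), Function.update_self,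
      ← Finset.mul_prod_erase _ (fun j => Real.Gamma (k * w j)) (Finset.mem_univ i)]
    have : ∏ j ∈ Finset.univ.erase i, Function.update x i t j ^ (k * w j - 1) =
        ∏ j ∈ Finset.univ.erase i, x j ^ (k * w j - 1) := by
      refine Finset.prod_congr rfl fun j hj => ?_
      rw [Function.update_of_ne (Finset.ne_of_mem_erase hj)]
    rw [this, auxK, show 1 - (t + ∑ j ∈ Finset.univ.erase i, x j) =
      1 - ∑ j ∈ Finset.univ.erase i, x j - t by ring]
    have h1 := (hG i).ne'
    have h2 : ∏ j ∈ Finset.univ.erase i, Real.Gamma (k * w j) ≠ 0 :=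
      Finset.prod_ne_zero_iff.2 fun j _ => (hG j).ne'
    have h3 := hG'.ne'
    field_simp
  · have hm : Function.update x i t ∉ auxS n τ := by
      rintro ⟨h1, h2⟩
      apply ht
      rw [aux_sum_update] at h2
      have := h1 i
      rw [Function.update_self] at this
      exact ⟨this, by linarith⟩
    rw [Set.indicator_of_notMem hm, Set.indicator_of_notMem ht, mul_zero]

lemma auxDens_update_zero (n : ℕ) (k τ : ℝ) (w : Fin n → ℝ) (i : Fin n) (x : Fin n → ℝ)
    (hx : ¬ ∀ j, j ≠ i → τ ≤ x j) (t : ℝ) :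
    auxDens n k τ w (Function.update x i t) = 0 := by
  unfold auxDens
  refine Set.indicator_of_notMem ?_ _
  rintro ⟨h1, -⟩
  refine hx fun j hj => ?_
  have := h1 j
  rwa [Function.update_of_ne hj] at this

lemma aux_cross (X Y G G' : ENNReal) (h1 : G ≠ 0) (h2 : G ≠ ⊤) (h3 : G' ≠ 0) (h4 : G' ≠ ⊤)
    (h : X * G ≤ Y * G') : G'⁻¹ * X ≤ G⁻¹ * Y := by
  rw [← ENNReal.div_eq_inv_mul, ← ENNReal.div_eq_inv_mul, ENNReal.div_le_iff h3 h4,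
    div_eq_mul_inv, mul_right_comm, ← div_eq_mul_inv,
    ENNReal.le_div_iff_mul_le (Or.inl h1) (Or.inl h2)]
  exact h

lemma aux_step (n : ℕ) (k τ η : ℝ) (hk : 0 < k) (hτ : 0 < τ) (hη : 0 < η) (w : Fin n → ℝ)
    (hw : ∀ j, η ≤ w j) (hw1 : η ≤ 1 - ∑ j, w j) (i : Fin n) :
    ∫⁻ x, auxDens n k τ (Function.update w i η) x ≤ ∫⁻ x, auxDens n k τ w x := by
  refine lintegral_le_of_lmarginal_le (μ := fun _ => volume) {i} (auxDens_meas _ _ _ _)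
    (auxDens_meas _ _ _ _) ?_
  rw [lmarginal_singleton, lmarginal_singleton]
  intro x
  simp only
  by_cases hx : ∀ j, j ≠ i → τ ≤ x j
  swap
  · simp_rw [auxDens_update_zero n k τ _ i x hx]; exact le_rfl
  have hsw := Finset.add_sum_erase Finset.univ w (Finset.mem_univ i)
  have hsu := aux_sum_update n i w η
  have hu0 : ∀ j, 0 < Function.update w i η j := by
    intro j
    by_cases hj : j = i
    · subst hj; rwa [Function.update_self]
    · rw [Function.update_of_ne hj]; exact hη.trans_le (hw j)
  have hu1 : ∑ j, Function.update w i η j < 1 := by have := hw i; linarith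
  have hK : auxK n k i (Function.update w i η) x = auxK n k i w x := by
    unfold auxK
    congr 1
    · congr 1
      refine Finset.prod_congr rfl fun j hj => ?_
      rw [Function.update_of_ne (Finset.ne_of_mem_erase hj)]
    · refine Finset.prod_congr rfl fun j hj => ?_
      rw [Function.update_of_ne (Finset.ne_of_mem_erase hj)]
  simp_rw [auxDens_update n k τ hk hτ _ hu0 hu1 i x hx,
    auxDens_update n k τ hk hτ w (fun j => hη.trans_le (hw j)) (by linarith) i x hx]
  rw [hK, Function.update_self,
    lintegral_const_mul _ ((auxF_meas _ _ _).indicator measurableSet_Icc),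
    lintegral_const_mul _ ((auxF_meas _ _ _).indicator measurableSet_Icc),
    lintegral_indicator measurableSet_Icc, lintegral_indicator measurableSet_Icc,
    mul_assoc, mul_assoc]
  gcongr 1
  have hone := aux_one_dim (k * w i) (k * (1 - ∑ j, w j)) (k * η)
    (k * (1 - ∑ j, Function.update w i η j)) (1 - ∑ j ∈ Finset.univ.erase i, x j) τ
    (by rw [← mul_add, ← mul_add]; congr 1; linarith) (mul_pos hk hη)
    (mul_le_mul_of_nonneg_left (hw i) hk.le) (mul_le_mul_of_nonneg_left hw1 hk.le) hτ
  have g1 : 0 < Real.Gamma (k * w i) * Real.Gamma (k * (1 - ∑ j, w j)) :=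
    mul_pos (Real.Gamma_pos_of_pos (mul_pos hk (hη.trans_le (hw i))))
      (Real.Gamma_pos_of_pos (mul_pos hk (hη.trans_le hw1)))
  have g2 : 0 < Real.Gamma (k * η) * Real.Gamma (k * (1 - ∑ j, Function.update w i η j)) :=
    mul_pos (Real.Gamma_pos_of_pos (mul_pos hk hη))
      (Real.Gamma_pos_of_pos (mul_pos hk (by linarith)))
  exact aux_cross _ _ _ _ (by simpa using g1) (by simp) (by simpa using g2) (by simp) hone

lemma aux_iter (n : ℕ) (k τ η : ℝ) (hk : 0 < k) (hτ : 0 < τ) (hη : 0 < η) (w : Fin n → ℝ)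
    (hw : ∀ j, η ≤ w j) (hw1 : η ≤ 1 - ∑ j, w j) :
    ∫⁻ x, auxDens n k τ (fun _ => η) x ≤ ∫⁻ x, auxDens n k τ w x := by
  have key : ∀ J : Finset (Fin n), ∫⁻ x, auxDens n k τ (J.piecewise (fun _ => η) w) x ≤
      ∫⁻ x, auxDens n k τ w x := by
    intro J
    induction J using Finset.induction_on with
    | empty => simp
    | insert j J hj ih =>
      rw [Finset.piecewise_insert]
      refine le_trans (aux_step n k τ η hk hτ hη _ ?_ ?_ j) ih
      · intro l
        by_cases hl : l ∈ J
        · rw [Finset.piecewise_eq_of_mem _ _ _ hl]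
        · rw [Finset.piecewise_eq_of_notMem _ _ _ hl]; exact hw l
      · have : ∑ l, J.piecewise (fun _ => η) w l ≤ ∑ l, w l := by
          refine Finset.sum_le_sum fun l _ => ?_
          by_cases hl : l ∈ J
          · rw [Finset.piecewise_eq_of_mem _ _ _ hl]; exact hw l
          · rw [Finset.piecewise_eq_of_notMem _ _ _ hl]
        linarith
  simpa using key Finset.univ

lemma aux_measure_eq (n : ℕ) (k τ : ℝ) (hτ : 0 < τ) (p : EuclideanSpace ℝ (Fin (n+1)))
    (hp : ∑ i, p i = 1) :
    dirichletMeasure n k p (restrictedSimplexCoord n τ) =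
      ∫⁻ x, auxDens n k τ (fun i => p i.castSucc) x := by
  have hlast : 1 - ∑ i : Fin n, p i.castSucc = p (Fin.last n) := by
    rw [Fin.sum_univ_castSucc] at hp; linarith
  have hset : restrictedSimplexCoord n τ = (WithLp.ofLp) ⁻¹' (auxS n τ) := by
    ext x
    simp only [restrictedSimplexCoord, simplexInterior, auxS, Set.mem_ofPred_eq, Set.mem_preimage]
    constructor
    · rintro ⟨-, h⟩; exact h
    · rintro ⟨h1, h2⟩
      exact ⟨⟨fun i => hτ.trans_le (h1 i), by linarith⟩, h1, h2⟩
  have hmeas : MeasurableSet (restrictedSimplexCoord n τ) := by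
    rw [hset]
    exact (PiLp.volume_preserving_ofLp (Fin n)).measurable (auxS_meas n τ)
  have hsub : restrictedSimplexCoord n τ ⊆ simplexInterior n := fun x hx => hx.1
  rw [dirichletMeasure, withDensity_apply _ hmeas, Measure.restrict_restrict hmeas,
    Set.inter_eq_left.2 hsub, ← lintegral_indicator hmeas,
    ← (PiLp.volume_preserving_ofLp (Fin n)).lintegral_comp (auxDens_meas _ _ _ _)]
  congr 1
  ext x
  unfold auxDens
  rw [hset, ← Set.indicator_comp_right]
  simp only [Function.comp_def, hlast, Fin.prod_univ_castSucc]

/-- for every p ∈ Δ_{m,η} (m = n+1), the Dirichlet probability of the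
τ-restricted simplex is minimized at the vertex p*: μ_{k,p}(S_τ) ≥ μ_{k,p*}(S_τ). -/
theorem dirichlet_probability_minimized_at_vertex
    (n : ℕ) (hn : 1 ≤ n) (k : ℝ) (hk : 0 < k)
    (η : ℝ) (hη : 0 < η) (hmη : ((n : ℝ) + 1) * η ≤ 1) (τ : ℝ) (hτ : 0 < τ) :
    ∀ p ∈ restrictedSimplex (n+1) η,
      dirichletMeasure n k (pstar n η) (restrictedSimplexCoord n τ) ≤
        dirichletMeasure n k p (restrictedSimplexCoord n τ) := by
  intro p hp
  obtain ⟨hp1, hp2⟩ := hp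
  have hs : ∑ i, pstar n η i = 1 := by
    rw [Fin.sum_univ_castSucc]
    simp [pstar, Fin.castSucc_ne_last]
  rw [aux_measure_eq n k τ hτ p hp1, aux_measure_eq n k τ hτ _ hs]
  have he : (fun i : Fin n => pstar n η i.castSucc) = fun _ => η := by
    ext i
    simp [pstar, Fin.castSucc_ne_last]
  rw [he]
  refine aux_iter n k τ η hk hτ hη _ (fun j => hp2 _) ?_
  have := hp2 (Fin.last n)
  rw [Fin.sum_univ_castSucc] at hp1
  linarith

end
end

section
/- Let m ≥ 1 and 0 < η with m·η ≤ 1. Let g : ℝ^m → ℝ be convex on Δ_{m,η} and invariant under permutations of coordinates (i.e., g(x ∘ σ) = g(x) for every permutation σ of {1,…,m} and every x). Then for every p ∈ Δ_{m,η}, one has g(p) ≤ g(p*). -/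
noncomputable section

/-- The vertex p* = (η, …, η, 1 − (m−1)·η) of Δ_{m,η}: the last coordinate (index m−1)
equals 1 − (m−1)·η and all other coordinates equal η. -/
def vertexPstar (m : ℕ) (η : ℝ) : EuclideanSpace ℝ (Fin m) :=
  WithLp.toLp 2 (fun i => if (i : ℕ) = m - 1 then 1 - ((m : ℝ) - 1) * η else η)

/-- a permutation-invariant function that is convex on Δ_{m,η} attains
its maximum over Δ_{m,η} at the vertex p*: g(p) ≤ g(p*) for all p ∈ Δ_{m,η}. -/
theorem symmetric_convex_max_at_vertex
    (m : ℕ) (hm : 1 ≤ m) (η : ℝ) (hη : 0 < η) (hmη : (m : ℝ) * η ≤ 1)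
    (g : EuclideanSpace ℝ (Fin m) → ℝ)
    (hconv : ConvexOn ℝ (restrictedSimplex m η) g)
    (hsymm : ∀ (σ : Equiv.Perm (Fin m)) (x : EuclideanSpace ℝ (Fin m)),
      g (WithLp.toLp 2 (fun i => x (σ i))) = g x) :
    ∀ p ∈ restrictedSimplex m η, g p ≤ g (vertexPstar m η) := by
  intro p hp
  obtain ⟨hsum, hge⟩ := hp
  set l : Fin m := ⟨m - 1, by omega⟩ with hl
  have hlast : ∀ i : Fin m, (i : ℕ) = m - 1 ↔ i = l := by
    intro i
    rw [hl, Fin.ext_iff]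
  have hmc : ∑ i : Fin m, (p i - η) = 1 - m * η := by
    rw [Finset.sum_sub_distrib, hsum]
    simp
  rcases hmη.eq_or_lt with hD | hD
  · have h0 : ∀ i, p i = η := by
      intro i
      have h1 := (Finset.sum_eq_zero_iff_of_nonneg
        (s := Finset.univ) (f := fun i => p i - η)
        (fun i _ => sub_nonneg.2 (hge i))).1 (by rw [hmc]; linarith) i (Finset.mem_univ i)
      linarith
    have : p = vertexPstar m η := by
      ext i
      rw [h0 i]
      simp only [vertexPstar]
      split_ifs
      · linarith
      · rfl
    rw [this]
  · have hDpos : 0 < 1 - (m : ℝ) * η := by linarith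
    let v : Fin m → EuclideanSpace ℝ (Fin m) := fun j =>
      WithLp.toLp 2 (fun i => vertexPstar m η (Equiv.swap j l i))
    have hv : ∀ j i, v j i = η + if i = j then 1 - (m : ℝ) * η else 0 := by
      intro j i
      have hsw : Equiv.swap j l i = l ↔ i = j := by
        rw [Equiv.apply_eq_iff_eq_symm_apply]
        simp
      simp only [v, vertexPstar, hlast, hsw]
      split_ifs
      · ring
      · ring
    have hgv : ∀ j, g (v j) = g (vertexPstar m η) := fun j => hsymm _ _
    have hmem : ∀ j, v j ∈ restrictedSimplex m η := by
      intro j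
      refine ⟨?_, ?_⟩
      · simp only [hv, Finset.sum_add_distrib]
        simp
      · intro i
        rw [hv]
        split_ifs <;> linarith
    let w : Fin m → ℝ := fun j => (p j - η) / (1 - (m : ℝ) * η)
    have hw1 : ∑ j, w j = 1 := by
      simp only [w]
      rw [← Finset.sum_div, hmc, div_self hDpos.ne']
    have hp : ∑ j, w j • v j = p := by
      ext i
      simp only [WithLp.ofLp_sum, WithLp.ofLp_smul, Finset.sum_apply, Pi.smul_apply, smul_eq_mul,
        hv, mul_add, Finset.sum_add_distrib, ← Finset.sum_mul, hw1]
      simp only [mul_ite, mul_zero, Finset.sum_ite_eq, Finset.mem_univ, if_true, w]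
      rw [div_mul_cancel₀ _ hDpos.ne']
      ring
    have hJ := hconv.map_sum_le (t := Finset.univ) (w := w) (p := v)
      (fun i _ => div_nonneg (sub_nonneg.2 (hge i)) hDpos.le) hw1 (fun i _ => hmem i)
    rw [hp] at hJ
    simpa only [hgv, smul_eq_mul, ← Finset.sum_mul, hw1, one_mul] using hJ

end
end
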